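/- Let N ≥ 1, 1 ≤ T ≤ N, a > 0, x ∈ [0, a], and let f_1, …, f_N : [0, a] → ℝ be integrable. Define L_i(x) = ∫_0^x f_i(z) dz and R_i(x) = ∫_x^a f_i(z) dz. Then ∑_{σ ∈ S_N} ∫_{0 ≤ z_1 ≤ ⋯ ≤ z_{T−1} ≤ x} ∫_{x ≤ z_{T+1} ≤ ⋯ ≤ z_N ≤ a} f_{σ(T)}(x) · ∏_{i=1}^{T−1} f_{σ(i)}(z_i) · ∏_{i=T+1}^{N} f_{σ(i)}(z_i) dz = ∑_{j=1}^{N} f_j(x) · ∑_{A ⊆ {1,…,N}∖{j}, |A| = T−1} ∏_{i ∈ A} L_i(x) · ∏_{i ∈ {1,…,N}∖(A ∪ {j})} R_i(x), where the outer sum on the left runs over all permutations σ of {1, …, N}, and the left-hand integrals are over the ordered simplices of the T−1 coordinates below x and the N−T coordinates above x. -/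

import Mathlib

open MeasureTheory

/-- Distinct coordinates agree only on a null set. -/
lemma volume_coord_eq {n : ℕ} {i j : Fin n} (h : i ≠ j) :
    volume {u : Fin n → ℝ | u i = u j} = 0 := by
  let S : Submodule ℝ (Fin n → ℝ) :=
    LinearMap.ker (LinearMap.proj (R := ℝ) (φ := fun _ : Fin n => ℝ) i - LinearMap.proj j)
  have hS : S ≠ ⊤ := by
    intro hS
    have : (Pi.single i 1 : Fin n → ℝ) ∈ S := by rw [hS]; trivial
    simp [S, h] at this
  have h2 := Measure.addHaar_submodule (volume : Measure (Fin n → ℝ)) S hS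
  convert h2 using 2
  ext u
  simp [S, sub_eq_zero]

lemma volume_not_injective (n : ℕ) :
    volume {u : Fin n → ℝ | ¬ Function.Injective u} = 0 := by
  have hsub : {u : Fin n → ℝ | ¬ Function.Injective u} ⊆
      ⋃ p : {p : Fin n × Fin n // p.1 ≠ p.2}, {u : Fin n → ℝ | u p.1.1 = u p.1.2} := by
    intro u hu
    simp only [Set.mem_ofPred_eq, Function.Injective, not_forall] at hu
    obtain ⟨i, j, h1, h2⟩ := hu
    exact Set.mem_iUnion.2 ⟨⟨(i, j), h2⟩, h1⟩
  exact measure_mono_null hsub (measure_iUnion_null fun p => volume_coord_eq p.2)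

/-- Ordered simplex in the cube. -/
def orderedSimplex (n : ℕ) (c d : ℝ) : Set (Fin n → ℝ) := {u | Monotone u ∧ ∀ i, u i ∈ Set.Icc c d}

lemma measurableSet_orderedSimplex (n : ℕ) (c d : ℝ) : MeasurableSet (orderedSimplex n c d) := by
  have : IsClosed (orderedSimplex n c d) := by
    have h1 : orderedSimplex n c d = (⋂ i, ⋂ j, ⋂ (_ : i ≤ j), {u : Fin n → ℝ | u i ≤ u j}) ∩
        ⋂ i, {u : Fin n → ℝ | u i ∈ Set.Icc c d} := by
      ext u; simp [orderedSimplex, Monotone]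
    rw [h1]
    refine IsClosed.inter ?_ ?_
    · exact isClosed_iInter fun i => isClosed_iInter fun j => isClosed_iInter fun _ =>
        isClosed_le (continuous_apply i) (continuous_apply j)
    · exact isClosed_iInter fun i => isClosed_Icc.preimage (continuous_apply i)
  exact this.measurableSet

lemma sum_perm_simplex (n : ℕ) (c d : ℝ) (g : Fin n → ℝ → ℝ)
    (hg : ∀ i, IntegrableOn (g i) (Set.Icc c d)) :
    ∑ τ : Equiv.Perm (Fin n), ∫ u in orderedSimplex n c d, ∏ i, g (τ i) (u i) =
      ∏ i, ∫ z in Set.Icc c d, g i z := by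
  let G : (Fin n → ℝ) → ℝ := fun u => ∏ i, g i (u i)
  let B : Equiv.Perm (Fin n) → Set (Fin n → ℝ) := fun τ => (fun u => u ∘ τ) ⁻¹' orderedSimplex n c d
  have hmeas : ∀ τ, MeasurableSet (B τ) := fun τ =>
    (measurableSet_orderedSimplex n c d).preimage
      (measurable_pi_lambda _ fun i => measurable_pi_apply (τ i))
  have h1 : ∀ τ : Equiv.Perm (Fin n),
      ∫ u in orderedSimplex n c d, ∏ i, g (τ i) (u i) = ∫ u in B τ, G u := by
    intro τ
    have mp := volume_measurePreserving_piCongrLeft (fun _ : Fin n => ℝ) τ.symm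
    have hfun : ⇑(MeasurableEquiv.piCongrLeft (fun _ : Fin n => ℝ) τ.symm) = fun u => u ∘ τ := by
      funext u
      funext i
      obtain ⟨k, rfl⟩ := τ.symm.surjective i
      rw [MeasurableEquiv.coe_piCongrLeft, Equiv.piCongrLeft_apply_apply]
      simp
    have := mp.setIntegral_preimage_emb (MeasurableEquiv.measurableEmbedding _)
      (fun u => ∏ i, g (τ i) (u i)) (orderedSimplex n c d)
    rw [← this, hfun]
    refine setIntegral_congr_fun (hmeas τ) fun u _ => ?_
    exact Equiv.prod_comp τ (fun i => g i (u i))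
  have hU : ⋃ τ, B τ = Set.univ.pi fun _ => Set.Icc c d := by
    ext u
    simp only [Set.mem_iUnion, Set.mem_pi, Set.mem_univ, true_imp_iff]
    constructor
    · rintro ⟨τ, h⟩ i
      simpa using h.2 (τ.symm i)
    · intro h
      exact ⟨Tuple.sort u, Tuple.monotone_sort u, fun i => h _⟩
  have hpi : (volume : Measure (Fin n → ℝ)).restrict (Set.univ.pi fun _ => Set.Icc c d) =
      Measure.pi fun _ => volume.restrict (Set.Icc c d) := by
    rw [volume_pi, Measure.restrict_pi_pi]
  have hint : IntegrableOn G (⋃ τ, B τ) := by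
    rw [hU, IntegrableOn, hpi]
    exact Integrable.fintype_prod hg
  have hd : Pairwise (Function.onFun (AEDisjoint volume) B) := by
    intro τ τ' hne
    refine measure_mono_null ?_ (volume_not_injective n)
    rintro u ⟨h, h'⟩ hinj
    apply hne
    have := Tuple.unique_monotone h.1 h'.1
    ext i
    exact congrArg _ (hinj (congrFun this i))
  simp_rw [h1]
  rw [← tsum_fintype (L := .unconditional _), ← integral_iUnion_ae (fun τ => (hmeas τ).nullMeasurableSet) hd hint, hU, hpi]
  exact integral_fintype_prod_eq_prod (𝕜 := ℝ) g

lemma sum_equiv_simplex {α : Type*} [DecidableEq α] (n : ℕ) (c d : ℝ) (f : α → ℝ → ℝ)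
    (hf : ∀ i, IntegrableOn (f i) (Set.Icc c d)) (A : Finset α) (hA : A.card = n) :
    ∑ e : Fin n ≃ A, ∫ u in orderedSimplex n c d, ∏ i, f (e i) (u i) =
      ∏ i ∈ A, ∫ z in Set.Icc c d, f i z := by
  let e0 : Fin n ≃ A := (Fintype.equivFinOfCardEq (by simpa using hA)).symm
  have := sum_perm_simplex n c d (fun i => f (e0 i)) (fun i => hf _)
  rw [← Finset.prod_coe_sort, ← Equiv.prod_comp e0, ← this,
    ← Equiv.sum_comp ((Equiv.refl (Fin n)).equivCongr e0)]
  rfl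

lemma fibre_sum {K M α : Type*} [Fintype K] [Fintype M] [Fintype α] [DecidableEq K]
    [DecidableEq M] [DecidableEq α] (G : (K → α) → ℝ) (H : (M → α) → ℝ) (j : α) (A : Finset α)
    (hj : j ∉ A) :
    ∑ s : K ⊕ Unit ⊕ M ≃ α with s (.inr (.inl ())) = j ∧ Finset.univ.image (fun k => s (.inl k)) = A,
      G (fun k => s (.inl k)) * H (fun m => s (.inr (.inr m))) =
    (∑ e : K ≃ A, G (fun k => e k)) *
      (∑ e : M ≃ ↥(Finset.univ.erase j \ A), H (fun m => e m)) := by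
  rw [Finset.sum_mul_sum, ← Finset.sum_product']
  symm
  have hbij : ∀ p : (K ≃ A) × (M ≃ ↥(Finset.univ.erase j \ A)), Function.Bijective
      (Sum.elim (fun k => (p.1 k : α)) (Sum.elim (fun _ : Unit => j) (fun m => (p.2 m : α)))) := by
    rintro ⟨p, q⟩
    constructor
    · have hq : ∀ m, (q m : α) ≠ j ∧ (q m : α) ∉ A := fun m => by
        have h := Finset.mem_sdiff.1 (q m).2
        exact ⟨(Finset.mem_erase.1 h.1).1, h.2⟩
      have hp : ∀ k, (p k : α) ∈ A := fun k => (p k).2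
      rintro (k | k | k) (l | l | l) h
      · simpa [Subtype.ext_iff.symm] using h
      · simp only [Sum.elim_inl, Sum.elim_inr] at h
        exact absurd (h ▸ hp k) hj
      · simp only [Sum.elim_inl, Sum.elim_inr] at h
        exact absurd (h ▸ hp k) (hq l).2
      · simp only [Sum.elim_inl, Sum.elim_inr] at h
        exact absurd (h ▸ hp l) hj
      · rfl
      · simp only [Sum.elim_inl, Sum.elim_inr] at h
        exact absurd h.symm (hq l).1
      · simp only [Sum.elim_inl, Sum.elim_inr] at h
        exact absurd (h ▸ hp l) (hq k).2
      · simp only [Sum.elim_inl, Sum.elim_inr] at h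
        exact absurd h (hq k).1
      · simpa [Subtype.ext_iff.symm] using h
    · intro b
      by_cases hb : b = j
      · exact ⟨.inr (.inl ()), by simp [hb]⟩
      by_cases hbA : b ∈ A
      · exact ⟨.inl (p.symm ⟨b, hbA⟩), by simp⟩
      · exact ⟨.inr (.inr (q.symm ⟨b, by simp [hb, hbA]⟩)), by simp⟩
  refine Finset.sum_bij (fun p _ => Equiv.ofBijective _ (hbij p)) ?_ ?_ ?_ ?_
  · rintro ⟨p, q⟩ -
    simp only [Finset.mem_filter, Finset.mem_univ, true_and, Equiv.ofBijective_apply,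
      Sum.elim_inl, Sum.elim_inr]
    ext b
    simp only [Finset.mem_image, Finset.mem_univ, true_and]
    constructor
    · rintro ⟨k, rfl⟩; exact (p k).2
    · intro hb; exact ⟨p.symm ⟨b, hb⟩, by simp⟩
  · rintro ⟨p, q⟩ - ⟨p', q'⟩ - h
    have h' := fun y => DFunLike.congr_fun h y
    refine Prod.ext ?_ ?_
    · ext k; simpa using h' (.inl k)
    · ext k; simpa using h' (.inr (.inr k))
  · intro s hs
    simp only [Finset.mem_filter, Finset.mem_univ, true_and] at hs
    obtain ⟨hs1, hs2⟩ := hs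
    have hk : ∀ k, s (.inl k) ∈ A := fun k => hs2 ▸ Finset.mem_image_of_mem _ (Finset.mem_univ k)
    have hm : ∀ m, s (.inr (.inr m)) ∈ Finset.univ.erase j \ A := fun m => by
      subst hs1 hs2
      simp
    refine ⟨⟨Equiv.ofBijective (fun k => ⟨s (.inl k), hk k⟩) ⟨?_, ?_⟩,
      Equiv.ofBijective (fun m => ⟨s (.inr (.inr m)), hm m⟩) ⟨?_, ?_⟩⟩, Finset.mem_univ _, ?_⟩
    · intro k l h; simpa using h
    · rintro ⟨b, hb⟩
      rw [← hs2] at hb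
      obtain ⟨k, -, hk'⟩ := Finset.mem_image.1 hb
      exact ⟨k, Subtype.ext hk'⟩
    · intro k l h; simpa using h
    · rintro ⟨b, hb⟩
      obtain ⟨y, rfl⟩ := s.surjective b
      rcases y with k | k | k
      · exact absurd (hk k) (Finset.mem_sdiff.1 hb).2
      · exact absurd hs1 (Finset.mem_erase.1 (Finset.mem_sdiff.1 hb).1).1
      · exact ⟨k, rfl⟩
    · ext y
      rcases y with k | k | k
      · rfl
      · exact hs1.symm
      · rfl
  · rintro ⟨p, q⟩ -
    simp

lemma equiv_sum {K M α : Type*} [Fintype K] [Fintype M] [Fintype α] [DecidableEq K]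
    [DecidableEq M] [DecidableEq α] (c : α → ℝ) (G : (K → α) → ℝ) (H : (M → α) → ℝ) :
    ∑ s : K ⊕ Unit ⊕ M ≃ α,
      c (s (.inr (.inl ()))) * (G (fun k => s (.inl k)) * H (fun m => s (.inr (.inr m)))) =
    ∑ j, c j * ∑ A ∈ Finset.powersetCard (Fintype.card K) (Finset.univ.erase j),
      (∑ e : K ≃ A, G (fun k => e k)) *
      (∑ e : M ≃ ↥(Finset.univ.erase j \ A), H (fun m => e m)) := by
  rw [← Finset.sum_fiberwise Finset.univ (fun s : K ⊕ Unit ⊕ M ≃ α => s (.inr (.inl ())))]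
  refine Finset.sum_congr rfl fun j _ => ?_
  have hmap : ∀ s ∈ Finset.univ.filter (fun s : K ⊕ Unit ⊕ M ≃ α => s (.inr (.inl ())) = j),
      Finset.univ.image (fun k => s (.inl k)) ∈
        Finset.powersetCard (Fintype.card K) (Finset.univ.erase j) := by
    intro s hs
    obtain rfl := (Finset.mem_filter.1 hs).2
    rw [Finset.mem_powersetCard]
    constructor
    · intro b hb
      obtain ⟨k, -, rfl⟩ := Finset.mem_image.1 hb
      simp
    · rw [Finset.card_image_of_injective _ (fun k l h => by simpa using h)]
      rfl
  rw [← Finset.sum_fiberwise_of_maps_to hmap, Finset.mul_sum]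
  refine Finset.sum_congr rfl fun A hA => ?_
  have hjA : j ∉ A := fun h => by
    simpa using (Finset.mem_powersetCard.1 hA).1 h
  rw [← fibre_sum G H j A hjA, Finset.filter_filter, Finset.mul_sum]
  refine Finset.sum_congr rfl fun s hs => ?_
  rw [(Finset.mem_filter.1 hs).2.1]

/-- Extended phase space integration with a tagged particle at position `x`: the sum over all
permutations of the iterated integrals over the ordered simplex of the `T-1` coordinates in
`[0, x]` and the ordered simplex of the `N-T` coordinates in `[x, a]` equals a sum over the
choice of the tagged function and of the subset of functions placed to the left, expressed
through the one-sided integrals `L_i(x) = ∫₀ˣ f i` and `R_i(x) = ∫ₓᵃ f i`. -/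
theorem extended_phase_space_integration_tagged (N T : ℕ) (hT : 1 ≤ T) (hTN : T ≤ N)
    (a : ℝ) (ha : 0 < a) (x : ℝ) (hx : x ∈ Set.Icc 0 a)
    (f : Fin N → ℝ → ℝ) (hf : ∀ i, IntegrableOn (f i) (Set.Icc 0 a)) :
    ∑ σ : Equiv.Perm (Fin N),
        ∫ u in {u : Fin (T - 1) → ℝ | Monotone u ∧ ∀ i, u i ∈ Set.Icc 0 x},
          ∫ v in {v : Fin (N - T) → ℝ | Monotone v ∧ ∀ i, v i ∈ Set.Icc x a},
            f (σ ⟨T - 1, by omega⟩) x *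
              (∏ i : Fin (T - 1), f (σ ⟨i.1, by have := i.2; omega⟩) (u i)) *
              (∏ i : Fin (N - T), f (σ ⟨T + i.1, by have := i.2; omega⟩) (v i)) =
      ∑ j : Fin N,
        f j x *
          ∑ A ∈ Finset.powersetCard (T - 1) (Finset.univ.erase j),
            (∏ i ∈ A, ∫ z in (0 : ℝ)..x, f i z) *
              ∏ i ∈ Finset.univ.erase j \ A, ∫ z in x..a, f i z := by
  have hfL : ∀ i, IntegrableOn (f i) (Set.Icc 0 x) := fun i =>
    (hf i).mono_set (Set.Icc_subset_Icc le_rfl hx.2)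
  have hfR : ∀ i, IntegrableOn (f i) (Set.Icc x a) := fun i =>
    (hf i).mono_set (Set.Icc_subset_Icc hx.1 le_rfl)
  let eFun : Fin (T - 1) ⊕ Unit ⊕ Fin (N - T) → Fin N :=
    Sum.elim (fun i => ⟨i.1, by have := i.2; omega⟩)
      (Sum.elim (fun _ => ⟨T - 1, by omega⟩) (fun i => ⟨T + i.1, by have := i.2; omega⟩))
  have heFun : Function.Bijective eFun := by
    rw [Fintype.bijective_iff_injective_and_card]
    constructor
    · rintro (⟨k, hk⟩ | k | ⟨k, hk⟩) (⟨l, hl⟩ | l | ⟨l, hl⟩) h <;>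
        simp [eFun] at h ⊢ <;> omega
    · simp; omega
  let e := Equiv.ofBijective eFun heFun
  have key := equiv_sum (K := Fin (T - 1)) (M := Fin (N - T)) (fun j => f j x)
    (fun p => ∫ u in orderedSimplex (T - 1) 0 x, ∏ i, f (p i) (u i))
    (fun p => ∫ v in orderedSimplex (N - T) x a, ∏ i, f (p i) (v i))
  trans
  swap
  · refine key.trans (Finset.sum_congr rfl fun j _ => ?_)
    refine congrArg _ (Finset.sum_congr (by simp) fun A hA => ?_)
    rw [Finset.mem_powersetCard] at hA
    rw [sum_equiv_simplex _ _ _ f hfL A hA.2, sum_equiv_simplex _ _ _ f hfR]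
    · simp_rw [intervalIntegral.integral_of_le hx.1, intervalIntegral.integral_of_le hx.2,
        integral_Icc_eq_integral_Ioc]
    · rw [Finset.card_sdiff_of_subset hA.1, hA.2, Finset.card_erase_of_mem (Finset.mem_univ _)]
      simp; omega
  · rw [← Equiv.sum_comp (e.symm.equivCongr (Equiv.refl (Fin N)))]
    refine Finset.sum_congr rfl fun σ _ => ?_
    simp_rw [mul_assoc, integral_const_mul, integral_mul_const]
    rfl
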